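/- For every complex matrix ρ indexed by X, the evolved state converges as t → ∞ (in the finite-dimensional matrix space) to the dephased fixed point: E_t(ρ ⊗ |1⟩⟨1|) → Σ_{c ∈ Bool} Π_c ρ Π_c ⊗ |c⟩⟨c|, where Π_c := Σ_{x ∈ X : C(x) = c} |x⟩⟨x|. -/

import Mathlib

open Matrix Filter
open scoped Kronecker Topology

attribute [local instance] Matrix.normedAddCommGroup Matrix.normedSpace

noncomputable section

/-- The computational basis of `n` qubits, `X = {0,1}ⁿ`. -/
abbrev QubitBasis (n : ℕ) := Fin n → Bool

/-- Evaluation of the 3-literal clause with indices `i₁ i₂ i₃` and bits `b₁ b₂ b₃`: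
`C(x) = ¬(x i₁ = b₁ ∧ x i₂ = b₂ ∧ x i₃ = b₃)`. -/
def clauseEval {n : ℕ} (i₁ i₂ i₃ : Fin n) (b₁ b₂ b₃ : Bool) (x : QubitBasis n) : Bool :=
  ! (decide (x i₁ = b₁) && decide (x i₂ = b₂) && decide (x i₃ = b₃))

/-- The Lindblad operator `L = Π⁻ ⊗ σ⁻` attached to a clause `C`:
`L((x,a),(y,b)) = 1` iff `x = y`, `C(x) = false`, `a = false`, `b = true`. -/
def jumpOp {n : ℕ} (C : QubitBasis n → Bool) :
    Matrix (QubitBasis n × Bool) (QubitBasis n × Bool) ℂ :=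
  Matrix.of fun p q =>
    if p.1 = q.1 ∧ C p.1 = false ∧ p.2 = false ∧ q.2 = true then 1 else 0

/-- The Lindbladian `ℒ(ρ) = γ (L ρ L† − (1/2)(L†L ρ + ρ L†L))` as a linear endomorphism
of the matrix space. -/
def lindbladian {d : Type*} [Fintype d] [DecidableEq d] (γ : ℝ) (L : Matrix d d ℂ) :
    Matrix d d ℂ →ₗ[ℂ] Matrix d d ℂ :=
  (γ : ℂ) • ((LinearMap.mulRight ℂ Lᴴ).comp (LinearMap.mulLeft ℂ L)
    - (1 / 2 : ℂ) • (LinearMap.mulLeft ℂ (Lᴴ * L) + LinearMap.mulRight ℂ (Lᴴ * L)))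

/-- The evolution `E_t = exp(t·ℒ)`, the exponential of the endomorphism `ℒ`. -/
def evol {d : Type*} [Fintype d] [DecidableEq d]
    (L : Matrix d d ℂ →ₗ[ℂ] Matrix d d ℂ) (t : ℝ) :
    Matrix d d ℂ →L[ℂ] Matrix d d ℂ :=
  haveI : IsTopologicalRing (Matrix d d ℂ →L[ℂ] Matrix d d ℂ) :=
    @NonUnitalSeminormedRing.toIsTopologicalRing _
      (@ContinuousLinearMap.toSeminormedRing ℂ (Matrix d d ℂ) _ _ _).toNonUnitalSeminormedRing
  NormedSpace.exp ((t : ℂ) • LinearMap.toContinuousLinearMap L)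

/-- The projector `Π_c = Σ_{x : C(x) = c} |x⟩⟨x|` onto the decoherence-free subspace. -/
def dfsProj {n : ℕ} (C : QubitBasis n → Bool) (c : Bool) :
    Matrix (QubitBasis n) (QubitBasis n) ℂ :=
  Matrix.diagonal fun x => if C x = c then 1 else 0

theorem exp_apply_eigen {E : Type*} [NormedAddCommGroup E] [NormedSpace ℂ E] [CompleteSpace E]
    (T : E →L[ℂ] E) (μ : ℂ) (v : E) (hTv : T v = μ • v) :
    (NormedSpace.exp T) v = Complex.exp μ • v := by
  have hpow : ∀ k : ℕ, (T ^ k) v = μ ^ k • v := by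
    intro k
    induction k with
    | zero => simp
    | succ k ih =>
      rw [pow_succ, mul_apply_eq_comp, hTv, map_smul, ih, smul_smul, pow_succ, mul_comm]
  have h1 : HasSum (fun k : ℕ => ((k.factorial : ℂ)⁻¹ • T ^ k)) (NormedSpace.exp T) :=
    NormedSpace.exp_series_hasSum_exp' (𝕂 := ℂ) T
  have h2 := h1.mapL (ContinuousLinearMap.apply ℂ E v)
  have h3 : HasSum (fun k : ℕ => ((k.factorial : ℂ)⁻¹ • μ ^ k)) (Complex.exp μ) := by
    rw [Complex.exp_eq_exp_ℂ]
    exact NormedSpace.exp_series_hasSum_exp' (𝕂 := ℂ) μ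
  have h4 := h3.smul_const v
  refine HasSum.unique (?_ : HasSum _ _) h4
  have h5 : (fun k : ℕ => ContinuousLinearMap.apply ℂ E v ((k.factorial : ℂ)⁻¹ • T ^ k)) =
      fun k : ℕ => ((k.factorial : ℂ)⁻¹ • μ ^ k) • v := by
    funext k
    simp [hpow, smul_smul]
  rw [h5] at h2
  exact h2

theorem evol_apply_eigen {d : Type*} [Fintype d] [DecidableEq d]
    (L : Matrix d d ℂ →ₗ[ℂ] Matrix d d ℂ) (t : ℝ) (μ : ℂ) (v : Matrix d d ℂ)
    (h : L v = μ • v) : evol L t v = Complex.exp (t * μ) • v := by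
  unfold evol
  have : CompleteSpace (Matrix d d ℂ) := FiniteDimensional.complete ℂ _
  have hv : ((t : ℂ) • LinearMap.toContinuousLinearMap L) v = (t * μ) • v := by
    simp [h, smul_smul]
  exact exp_apply_eigen (E := Matrix d d ℂ) ((t : ℂ) • LinearMap.toContinuousLinearMap L)
    (t * μ) v hv

theorem jumpOp_mul_apply {n : ℕ} (C : QubitBasis n → Bool)
    (M : Matrix (QubitBasis n × Bool) (QubitBasis n × Bool) ℂ) (p q) :
    (jumpOp C * M) p q = if C p.1 = false ∧ p.2 = false then M (p.1, true) q else 0 := by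
  rw [Matrix.mul_apply, Finset.sum_eq_single (p.1, true)]
  · simp [jumpOp]
  · rintro ⟨x, a⟩ - hne
    have : ¬ (p.1 = x ∧ C p.1 = false ∧ p.2 = false ∧ a = true) := by
      rintro ⟨h, -, -, h'⟩
      exact hne (by rw [h, h'])
    simp [jumpOp, this]
  · simp

theorem mul_jumpOp_conj_apply {n : ℕ} (C : QubitBasis n → Bool)
    (M : Matrix (QubitBasis n × Bool) (QubitBasis n × Bool) ℂ) (p q) :
    (M * (jumpOp C)ᴴ) p q = if C q.1 = false ∧ q.2 = false then M p (q.1, true) else 0 := by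
  have : M * (jumpOp C)ᴴ = (jumpOp C * Mᴴ)ᴴ := by simp
  rw [this, Matrix.conjTranspose_apply, jumpOp_mul_apply]
  split_ifs <;> simp

theorem jumpOp_conj_mul {n : ℕ} (C : QubitBasis n → Bool) :
    (jumpOp C)ᴴ * jumpOp C =
      Matrix.diagonal fun p => if C p.1 = false ∧ p.2 = true then 1 else 0 := by
  ext ⟨x, a⟩ ⟨y, b⟩
  rw [Matrix.mul_apply, Finset.sum_eq_single (x, false)]
  · by_cases hxy : x = y
    · subst hxy
      cases a <;> cases b <;> cases h : C x <;> simp [jumpOp, Matrix.diagonal_apply, h]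
    · simp [jumpOp, Matrix.diagonal_apply, hxy]
  · rintro ⟨z, c⟩ - hne
    have : ¬ (z = x ∧ C z = false ∧ c = false ∧ a = true) := by
      rintro ⟨h, -, h', -⟩
      exact hne (by rw [h, h'])
    simp [jumpOp, Matrix.conjTranspose_apply, this]
  · simp

theorem lindbladian_apply_apply {n : ℕ} (C : QubitBasis n → Bool) (γ : ℝ)
    (M : Matrix (QubitBasis n × Bool) (QubitBasis n × Bool) ℂ) (p q) :
    lindbladian γ (jumpOp C) M p q = γ * (
      (if C q.1 = false ∧ q.2 = false then
        (if C p.1 = false ∧ p.2 = false then M (p.1, true) (q.1, true) else 0) else 0)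
      - 1 / 2 * ((if C p.1 = false ∧ p.2 = true then 1 else 0) * M p q
        + M p q * (if C q.1 = false ∧ q.2 = true then 1 else 0))) := by
  have : lindbladian γ (jumpOp C) M = (γ : ℂ) • (jumpOp C * M * (jumpOp C)ᴴ
      - (1 / 2 : ℂ) • ((jumpOp C)ᴴ * jumpOp C * M + M * ((jumpOp C)ᴴ * jumpOp C))) := by
    simp [lindbladian, Matrix.mul_assoc]
  rw [this, jumpOp_conj_mul]
  simp only [Matrix.smul_apply, Matrix.sub_apply, Matrix.add_apply, Matrix.diagonal_mul,
    Matrix.mul_diagonal, mul_jumpOp_conj_apply, jumpOp_mul_apply, smul_eq_mul]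

/-- for every matrix `ρ`, `E_t(ρ ⊗ |1⟩⟨1|)` converges as `t → ∞` to the
dephased fixed point `Σ_c Π_c ρ Π_c ⊗ |c⟩⟨c|`. -/
theorem evol_tendsto_dephased {n : ℕ} (hn : 1 ≤ n)
    (i₁ i₂ i₃ : Fin n) (h₁₂ : i₁ ≠ i₂) (h₁₃ : i₁ ≠ i₃) (h₂₃ : i₂ ≠ i₃)
    (b₁ b₂ b₃ : Bool) (γ : ℝ) (hγ : 0 < γ)
    (C : QubitBasis n → Bool) (hC : C = clauseEval i₁ i₂ i₃ b₁ b₂ b₃)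
    (ρ : Matrix (QubitBasis n) (QubitBasis n) ℂ) :
    Tendsto
      (fun t : ℝ => evol (lindbladian γ (jumpOp C)) t (ρ ⊗ₖ Matrix.single true true (1 : ℂ)))
      atTop
      (𝓝 (∑ c : Bool, (dfsProj C c * ρ * dfsProj C c) ⊗ₖ Matrix.single c c (1 : ℂ))) := by
  clear hC
  set A := ∑ c : Bool, (dfsProj C c * ρ * dfsProj C c) ⊗ₖ Matrix.single c c (1 : ℂ) with hA
  set B := (dfsProj C true * ρ * dfsProj C false + dfsProj C false * ρ * dfsProj C true) ⊗ₖ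
    Matrix.single true true (1 : ℂ) with hB
  set D := (dfsProj C false * ρ * dfsProj C false) ⊗ₖ
    (Matrix.single true true (1 : ℂ) - Matrix.single false false (1 : ℂ)) with hD
  have hsum : ρ ⊗ₖ Matrix.single true true (1 : ℂ) = A + B + D := by
    ext ⟨x, a⟩ ⟨y, b⟩
    cases hx : C x <;> cases hy : C y <;> cases a <;> cases b <;>
      simp [hA, hB, hD, dfsProj, Matrix.kroneckerMap_apply, hx, hy, Matrix.single_apply]
  have eA : lindbladian γ (jumpOp C) A = (0 : ℂ) • A := by
    ext ⟨x, a⟩ ⟨y, b⟩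
    rw [lindbladian_apply_apply]
    cases hx : C x <;> cases hy : C y <;> cases a <;> cases b <;>
      simp [hA, dfsProj, Matrix.kroneckerMap_apply, hx, hy, Matrix.single_apply]
  have eB : lindbladian γ (jumpOp C) B = (-(γ / 2 : ℝ) : ℂ) • B := by
    ext ⟨x, a⟩ ⟨y, b⟩
    rw [lindbladian_apply_apply]
    cases hx : C x <;> cases hy : C y <;> cases a <;> cases b <;>
      simp [hB, dfsProj, Matrix.kroneckerMap_apply, hx, hy, Matrix.single_apply] <;> ring
  have eD : lindbladian γ (jumpOp C) D = (-(γ : ℝ) : ℂ) • D := by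
    ext ⟨x, a⟩ ⟨y, b⟩
    rw [lindbladian_apply_apply]
    cases hx : C x <;> cases hy : C y <;> cases a <;> cases b <;>
      simp [hD, dfsProj, Matrix.kroneckerMap_apply, hx, hy, Matrix.single_apply] <;> ring_nf <;> simp
  have hlim : ∀ s : ℝ, 0 < s → Tendsto (fun t : ℝ => Complex.exp (t * (-(s : ℝ) : ℂ)))
      atTop (𝓝 0) := by
    intro s hs
    rw [Complex.tendsto_exp_nhds_zero_iff]
    have : Tendsto (fun t : ℝ => t * (-s)) atTop atBot :=
      tendsto_id.atTop_mul_const_of_neg (by linarith)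
    simpa using this
  have hfun : (fun t : ℝ => evol (lindbladian γ (jumpOp C)) t
      (ρ ⊗ₖ Matrix.single true true (1 : ℂ))) = fun t : ℝ => A +
        Complex.exp (t * (-(γ / 2 : ℝ) : ℂ)) • B + Complex.exp (t * (-(γ : ℝ) : ℂ)) • D := by
    funext t
    rw [hsum, map_add, map_add, evol_apply_eigen _ t _ _ eA, evol_apply_eigen _ t _ _ eB,
      evol_apply_eigen _ t _ _ eD]
    simp
  rw [hfun]
  have h := (tendsto_const_nhds (x := A)).add ((hlim (γ / 2) (by positivity)).smul_const B)
    |>.add ((hlim γ hγ).smul_const D)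
  simpa only [zero_smul, add_zero] using h
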